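/- Assume λ and c are T-periodic and locally piecewise constant, and the stability condition holds. Then every solution (x, z) of the traffic flow model with piecewise constant initial history is bounded: there exists M > 0 such that x_i(t) ≤ M for every i ∈ E and every t ≥ 0. -/

import Mathlib

open MeasureTheory

variable {E : Type*}

/-- `f` is piecewise constant on the set `s`: there is a finite set `D` of breakpoints
such that `f` is constant between consecutive breakpoints (pieces are right-open). -/
def PwcOn (f : ℝ → ℝ) (s : Set ℝ) : Prop :=
  ∃ D : Finset ℝ, ∀ u ∈ s, ∀ v ∈ s, u ≤ v → (∀ d ∈ D, d ∉ Set.Ioc u v) → f u = f v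

/-- `f` is locally piecewise constant on `s`: piecewise constant on every compact
subinterval of `s`. -/
def LocPwcOn (f : ℝ → ℝ) (s : Set ℝ) : Prop :=
  ∀ a b : ℝ, PwcOn f (s ∩ Set.Icc a b)

/-- The maximum `δ̄` of the inter-link travel times over pairs `(j, i)` with `R j i > 0`
(and `0` if there are no such pairs). -/
noncomputable def dbar (R δ : E → E → ℝ) : ℝ :=
  sSup (insert 0 {d : ℝ | ∃ j i, 0 < R j i ∧ δ j i = d})

/-- `w ∈ ℝ^E` is feasible at time `t` for the traffic flow model:
`w i ≤ c t i` for every link `i`, and for every link `i` with empty queue (`x t i = 0`),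
`w i ≤ λ̃_i(t) + Σ_{j ∈ E_i} R j i * w j`, where `E_i = {j : R j i > 0 ∧ δ j i = 0}` and
`λ̃_i(t) = λ_i(t) + Σ_{j ∉ E_i} R j i * z (t - δ j i) j`. -/
def FeasibleAt (R δ : E → E → ℝ) (lam c : ℝ → E → ℝ) (x z : ℝ → E → ℝ)
    (t : ℝ) (w : E → ℝ) [Fintype E] : Prop :=
  (∀ i, w i ≤ c t i) ∧
  ∀ i, x t i = 0 →
    w i ≤ lam t i + ∑ j, R j i * (if δ j i = 0 then w j else z (t - δ j i) j)

/-- `(x, z)` is a solution of the traffic flow model with routing matrix `R`, travel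
times `δ`, external inflow `lam` and capacity `c`: queue lengths and outflows are
nonnegative, `z` is locally integrable on `[-δ̄, ∞)`, at every time `t ≥ 0` the outflow
`z t` is feasible and maximizes the cumulative outflow `Σ_i w i` among feasible vectors,
and the queue lengths satisfy the integral mass-balance equation. -/
def IsSolution [Fintype E] (R δ : E → E → ℝ) (lam c : ℝ → E → ℝ)
    (x z : ℝ → E → ℝ) : Prop :=
  (∀ t, 0 ≤ t → ∀ i, 0 ≤ x t i) ∧
  (∀ t, -(dbar R δ) ≤ t → ∀ i, 0 ≤ z t i) ∧
  (∀ i, LocallyIntegrableOn (fun t => z t i) (Set.Ici (-(dbar R δ)))) ∧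
  (∀ t, 0 ≤ t → FeasibleAt R δ lam c x z t (fun i => z t i)) ∧
  (∀ t, 0 ≤ t → ∀ w : E → ℝ, FeasibleAt R δ lam c x z t w → ∑ i, w i ≤ ∑ i, z t i) ∧
  (∀ t, 0 ≤ t → ∀ i,
    x t i = x 0 i + ∫ s in (0:ℝ)..t, (lam s i + ∑ j, R j i * z (s - δ j i) j - z s i))

/-- Reachability in the directed graph on links with an edge from `j` to `i`
whenever `R j i > 0`. -/
def Reach (R : E → E → ℝ) : E → E → Prop :=
  Relation.TransGen fun a b => 0 < R a b

/-- Connectivity assumption: the graph is weakly connected, all row sums of `R` are at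
most one, and from every link either its own row sum is less than one or a link with
row sum less than one is reachable. -/
def ConnAssumption [Fintype E] (R : E → E → ℝ) : Prop :=
  (∀ i j : E, i ≠ j → Reach R i j ∨ Reach R j i) ∧
  (∀ i : E, ∑ l, R i l ≤ 1) ∧
  (∀ i : E, (∑ l, R i l < 1) ∨ ∃ j, Reach R i j ∧ ∑ l, R j l < 1)

/-- Stability condition: `c̄_i − Σ_j R j i * c̄_j > λ̄_i` for every link `i`, where bars
denote averages over one period `[0, T]`. -/
def Stability [Fintype E] (T : ℝ) (R : E → E → ℝ) (lam c : ℝ → E → ℝ) : Prop :=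
  ∀ i : E, (1 / T) * ∫ s in (0:ℝ)..T, lam s i <
    (1 / T) * (∫ s in (0:ℝ)..T, c s i) -
      ∑ j, R j i * ((1 / T) * ∫ s in (0:ℝ)..T, c s j)

/-- A piecewise constant function is integrable on bounded intervals inside its domain. -/
theorem PwcOn.integrableOn_Icc {f : ℝ → ℝ} {a b : ℝ} (hf : PwcOn f (Set.Icc a b)) :
    IntegrableOn f (Set.Icc a b) := by
  classical
  obtain ⟨D, hD⟩ := hf
  set N : ℝ → ℕ := fun u => (D.filter (· ≤ u)).card with hN
  have hmono : Monotone N := fun u v huv =>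
    Finset.card_le_card (Finset.monotone_filter_right D fun d _ hd => le_trans hd huv)
  have hle : ∀ u ∈ Set.Icc a b, ∀ v ∈ Set.Icc a b, u ≤ v → N u = N v → f u = f v := by
    intro u hu v hv huv hNuv
    refine hD u hu v hv huv fun d hd hduv => ?_
    have hsub : D.filter (· ≤ u) ⊆ D.filter (· ≤ v) :=
      Finset.monotone_filter_right D fun d _ hd => le_trans hd huv
    have heq := Finset.eq_of_subset_of_card_le hsub (le_of_eq hNuv.symm)
    have hmem : d ∈ D.filter (· ≤ v) := Finset.mem_filter.2 ⟨hd, hduv.2⟩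
    rw [← heq] at hmem
    exact absurd (Finset.mem_filter.1 hmem).2 (not_le.2 hduv.1)
  have hfac : ∃ h : ℕ → ℝ, ∀ u ∈ Set.Icc a b, f u = h (N u) := by
    refine ⟨fun n => if hn : ∃ u ∈ Set.Icc a b, N u = n then f hn.choose else 0, fun u hu => ?_⟩
    have hn : ∃ v ∈ Set.Icc a b, N v = N u := ⟨u, hu, rfl⟩
    simp only [dif_pos hn]
    obtain ⟨h1, h2⟩ := hn.choose_spec
    rcases le_total u hn.choose with h | h
    · exact hle _ hu _ h1 h h2.symm
    · exact (hle _ h1 _ hu h h2).symm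
  obtain ⟨h, hh⟩ := hfac
  have hmeas : Measurable fun u => h (N u) := (measurable_from_nat).comp hmono.measurable
  have hint : IntegrableOn (fun u => h (N u)) (Set.Icc a b) := by
    refine Measure.integrableOn_of_bounded (M := ∑ n ∈ Finset.range (D.card + 1), |h n|)
      (by simp) hmeas.aestronglyMeasurable (Filter.Eventually.of_forall fun u => ?_)
    refine Finset.single_le_sum (f := fun n => |h n|) (fun n _ => abs_nonneg _) ?_
    exact Finset.mem_range.2 (Nat.lt_succ_of_le (Finset.card_filter_le _ _))
  exact hint.congr_fun (fun u hu => (hh u hu).symm) measurableSet_Icc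

theorem LocPwcOn.intervalIntegrable {f : ℝ → ℝ} (hf : LocPwcOn f (Set.Ici 0)) {a b : ℝ}
    (ha : 0 ≤ a) (hb : 0 ≤ b) : IntervalIntegrable f volume a b := by
  apply IntegrableOn.intervalIntegrable
  apply PwcOn.integrableOn_Icc
  have h := hf (min a b) (max a b)
  have hsub : Set.Icc (min a b) (max a b) ⊆ Set.Ici 0 := fun u hu => le_trans (le_min ha hb) hu.1
  rwa [Set.inter_eq_right.2 hsub] at h

/-- The primitive of a nonnegative function that is periodic on `[0, ∞)` stays within one
period's integral of the linear function with slope the mean value. -/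
theorem abs_integral_sub_mean_le {f : ℝ → ℝ} {T : ℝ} (hT : 0 < T)
    (hint : ∀ a b, 0 ≤ a → 0 ≤ b → IntervalIntegrable f volume a b)
    (hnn : ∀ t, 0 ≤ t → 0 ≤ f t) (hper : ∀ t, 0 ≤ t → f (t + T) = f t) {t : ℝ} (ht : 0 ≤ t) :
    |(∫ s in (0:ℝ)..t, f s) - t * ((1 / T) * ∫ s in (0:ℝ)..T, f s)| ≤ ∫ s in (0:ℝ)..T, f s := by
  have hmul : ∀ n : ℕ, ∫ s in (0:ℝ)..(n * T), f s = n * ∫ s in (0:ℝ)..T, f s := by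
    intro n
    induction n with
    | zero => simp
    | succ n ih =>
      have hnT : 0 ≤ (n : ℝ) * T := by positivity
      have hshift : ∫ s in T..(((n + 1 : ℕ) : ℝ) * T), f s = ∫ s in (0:ℝ)..(n * T), f s := by
        have h1 := intervalIntegral.integral_comp_add_right (a := 0) (b := n * T) f T
        rw [zero_add, show (n : ℝ) * T + T = ((n + 1 : ℕ) : ℝ) * T by push_cast; ring] at h1
        rw [← h1]
        refine intervalIntegral.integral_congr fun s hs => ?_
        rw [Set.uIcc_of_le hnT] at hs
        exact hper s hs.1
      rw [← intervalIntegral.integral_add_adjacent_intervals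
        (hint 0 T le_rfl hT.le) (hint T _ hT.le (by positivity)), hshift, ih]
      push_cast
      ring
  have hmono : ∀ a b, 0 ≤ a → a ≤ b → ∫ s in (0:ℝ)..a, f s ≤ ∫ s in (0:ℝ)..b, f s := by
    intro a b ha hab
    rw [← intervalIntegral.integral_add_adjacent_intervals
      (hint 0 a le_rfl ha) (hint a b ha (ha.trans hab))]
    have := intervalIntegral.integral_nonneg (μ := volume) hab fun u hu => hnn u (ha.trans hu.1)
    linarith
  set I := ∫ s in (0:ℝ)..T, f s with hI
  have hI0 : 0 ≤ I := intervalIntegral.integral_nonneg hT.le fun u hu => hnn u hu.1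
  set n := ⌊t / T⌋₊
  have hn1 : (n : ℝ) ≤ t / T := Nat.floor_le (by positivity)
  have hn2 : t / T < n + 1 := Nat.lt_floor_add_one _
  have hl := hmono (n * T) t (by positivity) ((le_div_iff₀ hT).1 hn1)
  have hu := hmono t ((n + 1 : ℕ) * T) ht (by push_cast; exact ((div_lt_iff₀ hT).1 hn2).le)
  rw [hmul] at hl hu
  push_cast at hu
  have he : t * (1 / T * I) = t / T * I := by ring
  rw [he, abs_le]
  constructor <;> nlinarith

theorem le_dbar [Finite E] {R δ : E → E → ℝ} {j i : E} (h : 0 < R j i) : δ j i ≤ dbar R δ := by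
  refine le_csSup (Set.Finite.bddAbove (Set.Finite.insert _ ?_)) (Or.inr ⟨j, i, h, rfl⟩)
  refine (Set.finite_range fun p : E × E => δ p.1 p.2).subset ?_
  rintro d ⟨j, i, -, rfl⟩
  exact ⟨(j, i), rfl⟩

theorem dbar_nonneg [Finite E] (R δ : E → E → ℝ) : 0 ≤ dbar R δ := by
  refine le_csSup (Set.Finite.bddAbove (Set.Finite.insert _ ?_)) (Or.inl rfl)
  refine (Set.finite_range fun p : E × E => δ p.1 p.2).subset ?_
  rintro d ⟨j, i, -, rfl⟩
  exact ⟨(j, i), rfl⟩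

/-- A link with a nonempty queue discharges at full capacity. -/
theorem IsSolution.outflow_eq_capacity [Fintype E] {R δ : E → E → ℝ} {lam c x z : ℝ → E → ℝ}
    (hRnn : ∀ j i, 0 ≤ R j i) (hsol : IsSolution R δ lam c x z) {t : ℝ} (ht : 0 ≤ t) {i : E}
    (hx : x t i ≠ 0) : z t i = c t i := by
  classical
  obtain ⟨-, -, -, hfeas, hmax, -⟩ := hsol
  obtain ⟨hzc, hzx⟩ := hfeas t ht
  refine le_antisymm (hzc i) ?_
  have hle : ∀ j, z t j ≤ Function.update (fun j => z t j) i (c t i) j := by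
    intro j
    by_cases hj : j = i
    · subst hj; simpa using hzc j
    · simp [hj]
  have hw := hmax t ht (Function.update (fun j => z t j) i (c t i)) ⟨fun j => ?_, fun j hj => ?_⟩
  · by_contra hlt
    exact absurd hw (not_le.2 (Finset.sum_lt_sum (fun j _ => hle j)
      ⟨i, Finset.mem_univ i, by simpa using hlt⟩))
  · by_cases hj : j = i
    · subst hj; simp
    · simpa [hj] using hzc j
  · have hji : j ≠ i := fun h => hx (h ▸ hj)
    rw [Function.update_of_ne hji]
    refine (hzx j hj).trans ?_
    gcongr with k
    · exact hRnn k j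
    · split_ifs
      · exact hle k
      · exact le_rfl

/-- If `z ≤ c` on `[0, ∞)` and `∫ c` grows at rate at most `m` up to an error `K`, then so does
`∫ z`, up to the mass of `z` before time `0`. -/
theorem integral_le_of_le_capacity {z c : ℝ → ℝ} {d m K : ℝ} (hd : 0 ≤ d) (hm : 0 ≤ m)
    (hz : ∀ a b, -d ≤ a → -d ≤ b → IntervalIntegrable z volume a b)
    (hc : ∀ a b, 0 ≤ a → 0 ≤ b → IntervalIntegrable c volume a b)
    (hznn : ∀ t, -d ≤ t → 0 ≤ z t) (hzc : ∀ t, 0 ≤ t → z t ≤ c t)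
    (hcK : ∀ a b, 0 ≤ a → a ≤ b → ∫ u in a..b, c u ≤ m * (b - a) + K)
    {a b : ℝ} (ha : -d ≤ a) (hab : a ≤ b) :
    ∫ u in a..b, z u ≤ (∫ u in (-d)..0, z u) + m * (b - a) + K := by
  have ha' : a ≤ max a 0 := le_max_left _ _
  have hb' : b ≤ max b 0 := le_max_left _ _
  have hab' : max a 0 ≤ max b 0 := max_le_max_right 0 hab
  have h0a : 0 ≤ max a 0 := le_max_right _ _
  have h0b : 0 ≤ max b 0 := le_max_right _ _
  have e1 := intervalIntegral.integral_add_adjacent_intervals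
    (hz a b ha (ha.trans hab)) (hz b (max b 0) (ha.trans hab) (by linarith))
  have e2 := intervalIntegral.integral_add_adjacent_intervals
    (hz a (max a 0) ha (by linarith)) (hz (max a 0) (max b 0) (by linarith) (by linarith))
  have h1 : 0 ≤ ∫ u in b..(max b 0), z u :=
    intervalIntegral.integral_nonneg hb' fun u hu => hznn u (by linarith [hu.1])
  have h2 : ∫ u in (max a 0)..(max b 0), z u ≤ ∫ u in (max a 0)..(max b 0), c u :=
    intervalIntegral.integral_mono_on hab' (hz _ _ (by linarith) (by linarith)) (hc _ _ h0a h0b)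
      fun u hu => hzc u (h0a.trans hu.1)
  have h3 := hcK _ _ h0a hab'
  have h4 : ∫ u in a..(max a 0), z u ≤ ∫ u in (-d)..0, z u := by
    rcases le_total 0 a with h | h
    · rw [max_eq_left h, intervalIntegral.integral_same]
      exact intervalIntegral.integral_nonneg (by linarith) fun u hu => hznn u hu.1
    · rw [max_eq_right h, ← intervalIntegral.integral_add_adjacent_intervals
        (hz (-d) a le_rfl ha) (hz a 0 ha (by linarith))]
      have := intervalIntegral.integral_nonneg (μ := volume) ha fun u hu => hznn u hu.1
      linarith
  have h5 : max b 0 - max a 0 ≤ b - a := by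
    rcases le_total 0 a with h | h
    · rw [max_eq_left h, max_eq_left (h.trans hab)]
    · rw [max_eq_right h, sub_zero]
      exact max_le (by linarith) (by linarith)
  nlinarith [mul_le_mul_of_nonneg_left h5 hm]

/-- A nonnegative continuous function whose growth over any interval `[s, t]`, on the interior of
which it does not vanish, is at most `K`, is bounded. -/
theorem le_add_of_growth_le {f : ℝ → ℝ} {K t : ℝ} (ht : 0 ≤ t)
    (hf : ContinuousOn f (Set.Icc 0 t)) (hf0 : 0 ≤ f 0)
    (hK : ∀ s, 0 ≤ s → s ≤ t → (∀ u ∈ Set.Ioc s t, f u ≠ 0) → f t ≤ f s + K) :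
    f t ≤ f 0 + K := by
  rcases (Set.Icc 0 t ∩ f ⁻¹' {0}).eq_empty_or_nonempty with h | h
  · refine hK 0 le_rfl ht fun u hu hu0 => ?_
    exact (Set.eq_empty_iff_forall_notMem.1 h) u ⟨⟨hu.1.le, hu.2⟩, hu0⟩
  · have hcomp : IsCompact (Set.Icc 0 t ∩ f ⁻¹' {0}) :=
      isCompact_Icc.of_isClosed_subset
        (hf.preimage_isClosed_of_isClosed isClosed_Icc isClosed_singleton) Set.inter_subset_left
    obtain ⟨s, ⟨hs, hs0⟩, hmax⟩ := hcomp.exists_isGreatest h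
    have := hK s hs.1 hs.2 fun u hu hu0 =>
      absurd (hmax ⟨⟨hs.1.trans hu.1.le, hu.2⟩, hu0⟩) (not_le.2 hu.1)
    rw [show f s = 0 from hs0] at this
    linarith

/-- Boundedness: if `λ` and `c` are `T`-periodic and locally piecewise constant and the
stability condition holds, then every solution of the traffic flow model with piecewise
constant initial history has bounded queue lengths. -/
theorem traffic_flow_bounded [Fintype E] [Nonempty E]
    (R δ : E → E → ℝ) (lam c : ℝ → E → ℝ) (x z : ℝ → E → ℝ) (T : ℝ)
    (hT : 0 < T) (hRnn : ∀ j i, 0 ≤ R j i) (hδnn : ∀ j i, 0 ≤ δ j i)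
    (hlam_nn : ∀ t, 0 ≤ t → ∀ i, 0 ≤ lam t i)
    (hc_nn : ∀ t, 0 ≤ t → ∀ i, 0 ≤ c t i)
    (hlam_pwc : ∀ i, LocPwcOn (fun t => lam t i) (Set.Ici 0))
    (hc_pwc : ∀ i, LocPwcOn (fun t => c t i) (Set.Ici 0))
    (hlam_per : ∀ t, 0 ≤ t → ∀ i, lam (t + T) i = lam t i)
    (hc_per : ∀ t, 0 ≤ t → ∀ i, c (t + T) i = c t i)
    (hstab : Stability T R lam c)
    (hsol : IsSolution R δ lam c x z)
    (hz_hist_pwc : ∀ i, PwcOn (fun t => z t i) (Set.Ico (-(dbar R δ)) 0)) :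
    ∃ M : ℝ, 0 < M ∧ ∀ i, ∀ t, 0 ≤ t → x t i ≤ M := by
  classical
  have hsol' := hsol
  obtain ⟨hx, hz, hzint, hfeas, -, hbal⟩ := hsol'
  have hd0 := dbar_nonneg R δ
  have hzi : ∀ i a b, -(dbar R δ) ≤ a → -(dbar R δ) ≤ b →
      IntervalIntegrable (fun t => z t i) volume a b := by
    intro i a b ha hb
    refine IntegrableOn.intervalIntegrable ((hzint i).integrableOn_compact_subset ?_ isCompact_uIcc)
    exact fun u hu => le_trans (le_min ha hb) hu.1
  have hci : ∀ i a b, 0 ≤ a → 0 ≤ b → IntervalIntegrable (fun t => c t i) volume a b :=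
    fun i a b ha hb => (hc_pwc i).intervalIntegrable ha hb
  have hli : ∀ i a b, 0 ≤ a → 0 ≤ b → IntervalIntegrable (fun t => lam t i) volume a b :=
    fun i a b ha hb => (hlam_pwc i).intervalIntegrable ha hb
  have hri : ∀ i j a b, 0 ≤ a → 0 ≤ b →
      IntervalIntegrable (fun s => R j i * z (s - δ j i) j) volume a b := by
    intro i j a b ha hb
    rcases (hRnn j i).eq_or_lt with h | h
    · simp [← h]
    · have hδ := le_dbar (δ := δ) h
      have := (hzi j (a - δ j i) (b - δ j i) (by linarith) (by linarith)).comp_sub_right (δ j i)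
      simp only [sub_add_cancel] at this
      exact this.const_mul _
  have hrs : ∀ i a b, 0 ≤ a → 0 ≤ b →
      IntervalIntegrable (fun s => ∑ j, R j i * z (s - δ j i) j) volume a b := by
    intro i a b ha hb
    have := IntervalIntegrable.sum Finset.univ fun j _ => hri i j a b ha hb
    simpa [Finset.sum_fn] using this
  have hni : ∀ i a b, 0 ≤ a → 0 ≤ b → IntervalIntegrable
      (fun s => lam s i + ∑ j, R j i * z (s - δ j i) j - z s i) volume a b := fun i a b ha hb =>
    ((hli i a b ha hb).add (hrs i a b ha hb)).sub (hzi i a b (by linarith) (by linarith))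
  set cm : E → ℝ := fun i => (1 / T) * ∫ s in (0:ℝ)..T, c s i with hcm
  set lm : E → ℝ := fun i => (1 / T) * ∫ s in (0:ℝ)..T, lam s i with hlm
  set ci : E → ℝ := fun i => ∫ s in (0:ℝ)..T, c s i with hcidef
  set li : E → ℝ := fun i => ∫ s in (0:ℝ)..T, lam s i with hlidef
  have hstab' : ∀ i, lm i < cm i - ∑ j, R j i * cm j := hstab
  have hcm0 : ∀ i, 0 ≤ cm i := fun i => mul_nonneg (by positivity)
    (intervalIntegral.integral_nonneg hT.le fun u hu => hc_nn u hu.1 i)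
  have hcb : ∀ i a b, 0 ≤ a → a ≤ b →
      |(∫ u in a..b, c u i) - cm i * (b - a)| ≤ 2 * ci i := by
    intro i a b ha hab
    have h1 := abs_integral_sub_mean_le hT (hci i) (fun t ht => hc_nn t ht i)
      (fun t ht => hc_per t ht i) ha
    have h2 := abs_integral_sub_mean_le hT (hci i) (fun t ht => hc_nn t ht i)
      (fun t ht => hc_per t ht i) (ha.trans hab)
    have h3 := intervalIntegral.integral_add_adjacent_intervals
      (hci i 0 a le_rfl ha) (hci i a b ha (ha.trans hab))
    rw [abs_le] at *
    simp only [hcm, hcidef]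
    constructor <;> linarith [h1.1, h1.2, h2.1, h2.2]
  have hlb : ∀ i a b, 0 ≤ a → a ≤ b → ∫ u in a..b, lam u i ≤ lm i * (b - a) + 2 * li i := by
    intro i a b ha hab
    have h1 := abs_integral_sub_mean_le hT (hli i) (fun t ht => hlam_nn t ht i)
      (fun t ht => hlam_per t ht i) ha
    have h2 := abs_integral_sub_mean_le hT (hli i) (fun t ht => hlam_nn t ht i)
      (fun t ht => hlam_per t ht i) (ha.trans hab)
    have h3 := intervalIntegral.integral_add_adjacent_intervals
      (hli i 0 a le_rfl ha) (hli i a b ha (ha.trans hab))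
    rw [abs_le] at *
    simp only [hlm, hlidef]
    linarith [h1.1, h1.2, h2.1, h2.2]
  set H : E → ℝ := fun j => (∫ u in (-(dbar R δ))..0, z u j) + 2 * ci j with hH
  have hrb : ∀ i j s t, 0 ≤ s → s ≤ t →
      ∫ u in s..t, R j i * z (u - δ j i) j ≤ R j i * cm j * (t - s) + R j i * H j := by
    intro i j s t hs hst
    rcases (hRnn j i).eq_or_lt with h | h
    · simp [← h]
    · have hδ := le_dbar (δ := δ) h
      have hb := integral_le_of_le_capacity hd0 (hcm0 j) (hzi j) (hci j)
        (fun t ht => hz t ht j) (fun t ht => (hfeas t ht).1 j)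
        (fun a b ha hab => by linarith [(abs_le.1 (hcb j a b ha hab)).2] :
          ∀ a b, 0 ≤ a → a ≤ b → ∫ u in a..b, c u j ≤ cm j * (b - a) + 2 * ci j)
        (a := s - δ j i) (b := t - δ j i) (by linarith) (by linarith)
      rw [intervalIntegral.integral_const_mul,
        intervalIntegral.integral_comp_sub_right (fun u => z u j)]
      have := mul_le_mul_of_nonneg_left hb h.le
      simp only [hH]
      linarith
  set K : E → ℝ := fun i => 2 * li i + ∑ j, R j i * H j + 2 * ci i with hK
  have hbound : ∀ i t, 0 ≤ t → x t i ≤ x 0 i + K i := by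
    intro i t ht
    refine le_add_of_growth_le (f := fun u => x u i) ht ?_ (hx 0 le_rfl i) fun s hs hst hpos => ?_
    · refine ContinuousOn.congr (f := fun t => x 0 i +
        ∫ s in (0:ℝ)..t, (lam s i + ∑ j, R j i * z (s - δ j i) j - z s i)) ?_
        fun u hu => hbal u hu.1 i
      refine continuousOn_const.add ?_
      have := intervalIntegral.continuousOn_primitive_interval'
        (hni i 0 t le_rfl ht) Set.left_mem_uIcc
      rwa [Set.uIcc_of_le ht] at this
    · have e1 := intervalIntegral.integral_add_adjacent_intervals
        (hni i 0 s le_rfl hs) (hni i s t hs ht)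
      have e2 : ∫ u in s..t, (lam u i + ∑ j, R j i * z (u - δ j i) j - z u i) =
          (∫ u in s..t, lam u i) + (∑ j, ∫ u in s..t, R j i * z (u - δ j i) j) -
            ∫ u in s..t, z u i := by
        rw [intervalIntegral.integral_sub ((hli i s t hs ht).add (hrs i s t hs ht))
          (hzi i s t (by linarith) (by linarith)),
          intervalIntegral.integral_add (hli i s t hs ht) (hrs i s t hs ht),
          intervalIntegral.integral_finsetSum fun j _ => hri i j s t hs ht]
      have e3 : ∫ u in s..t, z u i = ∫ u in s..t, c u i := by
        refine intervalIntegral.integral_congr_ae (Filter.Eventually.of_forall fun u hu => ?_)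
        rw [Set.uIoc_of_le hst] at hu
        exact hsol.outflow_eq_capacity hRnn (hs.trans hu.1.le) (hpos u hu)
      have h1 := hlb i s t hs hst
      have h2 : ∑ j, ∫ u in s..t, R j i * z (u - δ j i) j ≤
          (∑ j, R j i * cm j) * (t - s) + ∑ j, R j i * H j := by
        rw [Finset.sum_mul, ← Finset.sum_add_distrib]
        exact Finset.sum_le_sum fun j _ => hrb i j s t hs hst
      have h3 := (abs_le.1 (hcb i s t hs hst)).1
      have h4 := mul_le_mul_of_nonneg_right (hstab' i).le (sub_nonneg.2 hst)
      have h5 := hbal t ht i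
      have h6 := hbal s hs i
      simp only [hK]
      linarith
  refine ⟨1 + ∑ i, |x 0 i + K i|, by positivity, fun i t ht => ?_⟩
  have h1 := hbound i t ht
  have h2 := le_abs_self (x 0 i + K i)
  have h3 := Finset.single_le_sum (f := fun i => |x 0 i + K i|) (fun j _ => abs_nonneg _)
    (Finset.mem_univ i)
  linarith
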